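/- arXiv:1009.0854 — 2 statements merged into one kernel-verified Lean document; each statement's English description precedes it below -/
import Mathlib

section
/- Let R, G, B be reals with B > G and R ≥ G (and not R = G = B). Set H₀ = arccos(0.5(R−G+R−B)/√((R−G)² + (R−B)(G−B))) and H = 2π − H₀. If additionally R > B, then H = 5π/3 + arctan(√3(R−B)/(R−G+B−G)). -/
theorem kender_hue_sector_BG (R G B : ℝ)
    (hBG : B > G) (hRG : R ≥ G) (hne : ¬(R = G ∧ G = B)) (hRB : R > B)
    (hden : R - G + (B - G) > 0)
    (hdisc : (R - G) ^ 2 + (R - B) * (G - B) > 0)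
    (H₀ H : ℝ)
    (hH₀ : H₀ = Real.arccos
      (0.5 * (R - G + (R - B)) / Real.sqrt ((R - G) ^ 2 + (R - B) * (G - B))))
    (hH : H = 2 * Real.pi - H₀) :
    H = 5 * Real.pi / 3 + Real.arctan (Real.sqrt 3 * (R - B) / (R - G + (B - G))) := by
  set d := R - G + (B - G) with hd
  set D := (R - G) ^ 2 + (R - B) * (G - B) with hD
  set x := Real.sqrt 3 * (R - B) / d with hx
  have h3 : Real.sqrt 3 ^ 2 = 3 := Real.sq_sqrt (by norm_num)
  have hsD : 0 < Real.sqrt D := Real.sqrt_pos.mpr hdisc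
  have hx0 : 0 ≤ x := div_nonneg (mul_nonneg (Real.sqrt_nonneg 3) (by linarith)) hden.le
  have hx3 : x ≤ Real.sqrt 3 := by
    rw [hx, div_le_iff₀ hden]
    exact mul_le_mul_of_nonneg_left (by linarith) (Real.sqrt_nonneg 3)
  have hsqrt : Real.sqrt (1 + x ^ 2) = 2 * Real.sqrt D / d := by
    rw [Real.sqrt_eq_iff_mul_self_eq (by positivity) (by positivity), ← sq, hx]
    simp only [div_pow, mul_pow, h3, Real.sq_sqrt hdisc.le]
    field_simp
    rw [hd, hD]
    ring
  have harctan : Real.arctan x ≤ Real.pi / 3 :=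
    Real.arctan_sqrt_three ▸ Real.arctan_mono hx3
  have hcos : Real.cos (Real.pi / 3 - Real.arctan x) =
      0.5 * (R - G + (R - B)) / Real.sqrt D := by
    rw [Real.cos_sub, Real.cos_pi_div_three, Real.sin_pi_div_three, Real.cos_arctan,
      Real.sin_arctan, hsqrt, hx]
    field_simp
    rw [h3, hd]
    ring
  rw [hH, hH₀, ← hcos, Real.arccos_cos (by linarith)
    (by linarith [Real.pi_pos, Real.arctan_nonneg.mpr hx0])]
  ring
end

section
/- There exists a polynomial P of degree 2 such that sup_{x∈[0,1]} |arctan(x) − P(x)| ≤ 0.007. -/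
open Set

theorem sub_cube_div_three_le_arctan {x : ℝ} (hx : 0 ≤ x) :
    x - x ^ 3 / 3 ≤ Real.arctan x := by
  have hd (y : ℝ) : HasDerivAt (fun t ↦ Real.arctan t - (t - t ^ 3 / 3))
      (y ^ 4 / (1 + y ^ 2)) y := by
    refine ((Real.hasDerivAt_arctan y).sub
      ((hasDerivAt_id' y).sub ((hasDerivAt_pow 3 y).div_const 3))).congr_deriv ?_
    field_simp
    ring
  have hmono := monotone_of_hasDerivAt_nonneg hd fun y ↦ by simp only [Pi.zero_apply]; positivity
  have := hmono hx
  simp only [Real.arctan_zero] at this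
  linarith

theorem arctan_le_sub_cube_add_pow_five {x : ℝ} (hx : 0 ≤ x) :
    Real.arctan x ≤ x - x ^ 3 / 3 + x ^ 5 / 5 := by
  have hd (y : ℝ) : HasDerivAt (fun t ↦ t - t ^ 3 / 3 + t ^ 5 / 5 - Real.arctan t)
      (y ^ 6 / (1 + y ^ 2)) y := by
    refine ((((hasDerivAt_id' y).sub ((hasDerivAt_pow 3 y).div_const 3)).add
      ((hasDerivAt_pow 5 y).div_const 5)).sub (Real.hasDerivAt_arctan y)).congr_deriv ?_
    field_simp
    ring
  have hmono := monotone_of_hasDerivAt_nonneg hd fun y ↦ by simp only [Pi.zero_apply]; positivity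
  have := hmono hx
  simp only [Real.arctan_zero] at this
  linarith

/-- The slope `475 / 442` and the curvature `125 / 442` are chosen so that the critical points
are `1 / 5`, `3 / 5` and `11 / 10`. -/
theorem hasDerivAt_arctan_sub_quadratic (x : ℝ) :
    HasDerivAt (fun t ↦ Real.arctan t - (475 / 442 * t - 125 / 442 * t ^ 2))
      (125 / 221 * ((x - 1 / 5) * (x - 3 / 5) * (x - 11 / 10)) / (1 + x ^ 2)) x := by
  refine ((Real.hasDerivAt_arctan x).sub (((hasDerivAt_id' x).const_mul _).sub
    ((hasDerivAt_pow 2 x).const_mul _))).congr_deriv ?_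
  field_simp
  ring

theorem antitoneOn_arctan_sub_quadratic_left :
    AntitoneOn (fun t ↦ Real.arctan t - (475 / 442 * t - 125 / 442 * t ^ 2)) (Icc 0 (1 / 5)) := by
  refine antitoneOn_of_hasDerivWithinAt_nonpos (convex_Icc _ _)
    (fun x _ ↦ (hasDerivAt_arctan_sub_quadratic x).continuousAt.continuousWithinAt)
    (fun x _ ↦ (hasDerivAt_arctan_sub_quadratic x).hasDerivWithinAt) fun x hx ↦ ?_
  rw [interior_Icc] at hx
  have h := mul_nonneg (mul_nonneg (sub_nonneg.2 hx.2.le)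
    (by linarith [hx.2] : 0 ≤ 3 / 5 - x)) (by linarith [hx.2] : 0 ≤ 11 / 10 - x)
  exact div_nonpos_of_nonpos_of_nonneg (by linarith) (by positivity)

theorem monotoneOn_arctan_sub_quadratic :
    MonotoneOn (fun t ↦ Real.arctan t - (475 / 442 * t - 125 / 442 * t ^ 2))
      (Icc (1 / 5) (3 / 5)) := by
  refine monotoneOn_of_hasDerivWithinAt_nonneg (convex_Icc _ _)
    (fun x _ ↦ (hasDerivAt_arctan_sub_quadratic x).continuousAt.continuousWithinAt)
    (fun x _ ↦ (hasDerivAt_arctan_sub_quadratic x).hasDerivWithinAt) fun x hx ↦ ?_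
  rw [interior_Icc] at hx
  have h := mul_nonneg (mul_nonneg (sub_nonneg.2 hx.1.le)
    (sub_nonneg.2 hx.2.le)) (by linarith [hx.2] : 0 ≤ 11 / 10 - x)
  exact div_nonneg (by linarith) (by positivity)

theorem antitoneOn_arctan_sub_quadratic_right :
    AntitoneOn (fun t ↦ Real.arctan t - (475 / 442 * t - 125 / 442 * t ^ 2)) (Icc (3 / 5) 1) := by
  refine antitoneOn_of_hasDerivWithinAt_nonpos (convex_Icc _ _)
    (fun x _ ↦ (hasDerivAt_arctan_sub_quadratic x).continuousAt.continuousWithinAt)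
    (fun x _ ↦ (hasDerivAt_arctan_sub_quadratic x).hasDerivWithinAt) fun x hx ↦ ?_
  rw [interior_Icc] at hx
  have h := mul_nonneg (mul_nonneg (by linarith [hx.1] : 0 ≤ x - 1 / 5)
    (sub_nonneg.2 hx.1.le)) (by linarith [hx.2] : 0 ≤ 11 / 10 - x)
  exact div_nonpos_of_nonpos_of_nonneg (by linarith) (by positivity)

theorem arctan_sub_quadratic_mem_Icc {x : ℝ} (hx : x ∈ Icc (0 : ℝ) 1) :
    Real.arctan x - (475 / 442 * x - 125 / 442 * x ^ 2) ∈ Icc (-0.01 : ℝ) 0.002 := by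
  have hl := sub_cube_div_three_le_arctan (x := 1 / 5) (by norm_num)
  have hu := arctan_le_sub_cube_add_pow_five (x := 3 / 5) (by norm_num)
  have hπ := Real.pi_gt_d2
  rcases le_total x (1 / 5) with h₁ | h₁
  · have ha := antitoneOn_arctan_sub_quadratic_left ⟨le_rfl, by norm_num⟩ ⟨hx.1, h₁⟩ hx.1
    have hb := antitoneOn_arctan_sub_quadratic_left ⟨hx.1, h₁⟩ ⟨by norm_num, le_rfl⟩ h₁
    simp only [Real.arctan_zero] at ha hb
    constructor <;> linarith
  rcases le_total x (3 / 5) with h₂ | h₂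
  · have ha := monotoneOn_arctan_sub_quadratic ⟨le_rfl, by norm_num⟩ ⟨h₁, h₂⟩ h₁
    have hb := monotoneOn_arctan_sub_quadratic ⟨h₁, h₂⟩ ⟨by norm_num, le_rfl⟩ h₂
    simp only at ha hb
    constructor <;> linarith
  · have ha := antitoneOn_arctan_sub_quadratic_right ⟨le_rfl, by norm_num⟩ ⟨h₂, hx.2⟩ h₂
    have hb := antitoneOn_arctan_sub_quadratic_right ⟨h₂, hx.2⟩ ⟨by norm_num, le_rfl⟩ hx.2
    simp only [Real.arctan_one] at ha hb
    constructor <;> linarith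

theorem arctan_deg2_minimax :
    ∃ P : Polynomial ℝ, P.natDegree = 2 ∧
      ∀ x ∈ Set.Icc (0:ℝ) 1, |Real.arctan x - P.eval x| ≤ 0.007 := by
  refine ⟨.C (-125 / 442) * .X ^ 2 + .C (475 / 442) * .X + .C (-0.004),
    Polynomial.natDegree_quadratic (by norm_num), fun x hx ↦ ?_⟩
  obtain ⟨hl, hu⟩ := arctan_sub_quadratic_mem_Icc hx
  simp only [Polynomial.eval_add, Polynomial.eval_mul, Polynomial.eval_C, Polynomial.eval_pow,
    Polynomial.eval_X]
  rw [abs_le]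
  constructor <;> linarith
end
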